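/- arXiv:math/0403093 — 4 statements merged into one kernel-verified Lean document; each statement's English description precedes it below -/
import Mathlib

section
/- Let X be a direct limit sequence of topological spaces (X_n, t_n). Suppose U_n ⊆ X_n is t_n-open for each n and U_1 ⊆ U_2 ⊆ ⋯. Then U := ⋃_{n∈ℕ} U_n is open in X, and on U the final topology with respect to the inclusion maps (U_n, subspace topology induced by t_n) → U coincides with the subspace topology induced by X. -/
/-- In a direct limit sequence, the union of an increasing sequence of sets whose `n`-th member
has an open trace on the `n`-th step is open. -/
theorem isOpen_iUnion_of_monotone_of_isOpen_preimage {X : Type*} [TopologicalSpace X]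
    {A : ℕ → Set X} {t : ∀ n, TopologicalSpace (A n)} (hmono : Monotone A)
    (hincl : ∀ m n (h : m ≤ n),
      @Continuous _ _ (t m) (t n) (Set.inclusion (hmono h)))
    (hfinal : ∀ W : Set X, IsOpen W ↔
      ∀ n, @IsOpen _ (t n) ((Subtype.val : A n → X) ⁻¹' W))
    {V : ℕ → Set X} (hVopen : ∀ n, @IsOpen _ (t n) ((Subtype.val : A n → X) ⁻¹' V n))
    (hVmono : Monotone V) : IsOpen (⋃ n, V n) := by
  refine (hfinal _).2 fun n => ?_
  have key : (Subtype.val : A n → X) ⁻¹' (⋃ m, V m) =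
      ⋃ k, Set.inclusion (hmono (Nat.le_add_right n k)) ⁻¹'
        ((Subtype.val : A (n + k) → X) ⁻¹' V (n + k)) := by
    ext x
    simp only [Set.mem_preimage, Set.mem_iUnion]
    exact ⟨fun ⟨m, hm⟩ => ⟨m, hVmono (Nat.le_add_left m n) hm⟩, fun ⟨k, hk⟩ => ⟨n + k, hk⟩⟩
  rw [key]
  let _ := t n
  exact isOpen_iUnion fun k => (hVopen (n + k)).preimage (hincl n (n + k) (Nat.le_add_right n k))

/-- Lemma 1.7(b): if `U n ⊆ A n` are `t n`-open and increasing, then `U := ⋃ n, U n` is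
open in the direct limit `X`, and on `U` the final topology with respect to the
inclusion maps `U n → U` (each `U n` carrying the subspace topology induced by `t n`,
in which it is open, so that relatively open subsets of `U n` are exactly the
`t n`-open subsets contained in `U n`) coincides with the topology induced by `X`. -/
theorem isOpen_iUnion_of_directLimitSequence {X : Type*} [TopologicalSpace X]
    (A : ℕ → Set X) (t : ∀ n, TopologicalSpace (A n))
    (hmono : Monotone A)
    (hunion : ⋃ n, A n = Set.univ)
    (hincl : ∀ m n (h : m ≤ n),
      @Continuous _ _ (t m) (t n) (Set.inclusion (hmono h)))
    (hfinal : ∀ W : Set X, IsOpen W ↔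
      ∀ n, @IsOpen _ (t n) ((Subtype.val : A n → X) ⁻¹' W))
    (U : ℕ → Set X) (hUA : ∀ n, U n ⊆ A n)
    (hUopen : ∀ n, @IsOpen _ (t n) ((Subtype.val : A n → X) ⁻¹' U n))
    (hUmono : Monotone U) :
    IsOpen (⋃ n, U n) ∧
      ∀ V : Set X, V ⊆ ⋃ n, U n →
        ((∃ W : Set X, IsOpen W ∧ V = W ∩ ⋃ n, U n) ↔
          ∀ n, @IsOpen _ (t n) ((Subtype.val : A n → X) ⁻¹' (V ∩ U n))) := by
  have hU := isOpen_iUnion_of_monotone_of_isOpen_preimage hmono hincl hfinal hUopen hUmono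
  refine ⟨hU, fun V hV => ⟨?_, fun h => ⟨V, ?_, (Set.inter_eq_left.2 hV).symm⟩⟩⟩
  · rintro ⟨W, hW, rfl⟩ n
    rw [Set.inter_assoc, Set.inter_eq_right.2 (Set.subset_iUnion U n), Set.preimage_inter]
    let _ := t n
    exact ((hfinal W).1 hW n).inter (hUopen n)
  · rw [← Set.inter_eq_left.2 hV, Set.inter_iUnion]
    exact isOpen_iUnion_of_monotone_of_isOpen_preimage hmono hincl hfinal h
      fun _ _ hmn => Set.inter_subset_inter_right V (hUmono hmn)
end

section
/- Let X be a direct limit sequence of topological spaces (X_n, t_n), where each (X_n, t_n) is a T1 space. Let Q_n ⊆ X_n be t_n-open sets with Q_1 ⊆ Q_2 ⊆ ⋯, and set Q := ⋃_{n∈ℕ} Q_n. Let Y be a metrizable topological space, f : Y → X a continuous map, and y ∈ Y a point with f(y) ∈ Q. Then there exist n ∈ ℕ and an open neighbourhood S of y in Y such that f(S) ⊆ Q_n. -/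
/-- In a direct limit sequence of T1 spaces, the union of increasing open sets `Q n ⊆ A n` stays
open after removing a set that meets every `Q n` in a finite set. -/
theorem isOpen_iUnion_diff_of_directLimitSequence {X : Type*} [TopologicalSpace X]
    (A : ℕ → Set X) (t : ∀ n, TopologicalSpace (A n))
    (hmono : Monotone A)
    (hincl : ∀ m n (h : m ≤ n),
      @Continuous _ _ (t m) (t n) (Set.inclusion (hmono h)))
    (hfinal : ∀ U : Set X, IsOpen U ↔
      ∀ n, @IsOpen _ (t n) ((Subtype.val : A n → X) ⁻¹' U))
    (hT1 : ∀ n, @T1Space _ (t n))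
    (Q : ℕ → Set X)
    (hQopen : ∀ n, @IsOpen _ (t n) ((Subtype.val : A n → X) ⁻¹' Q n))
    (hQmono : Monotone Q) (C : Set X) (hC : ∀ n, (Q n ∩ C).Finite) :
    IsOpen ((⋃ n, Q n) \ C) := by
  have hdiff (n : ℕ) : @IsOpen _ (t n) ((Subtype.val : A n → X) ⁻¹' (Q n \ C)) := by
    let := t n
    have := hT1 n
    have hfin : ((Subtype.val : A n → X) ⁻¹' (Q n ∩ C)).Finite :=
      (hC n).preimage Subtype.val_injective.injOn
    rw [← Set.sdiff_inter_self_eq_sdiff, Set.inter_comm, Set.preimage_sdiff]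
    exact (hQopen n).sdiff hfin.isClosed
  refine (hfinal _).2 fun m => ?_
  let := t m
  refine isOpen_iff_forall_mem_open.2 fun x hx => ?_
  obtain ⟨hxQ, hxC⟩ := hx
  obtain ⟨n, hn⟩ := Set.mem_iUnion.1 hxQ
  let := t (max m n)
  refine ⟨Set.inclusion (hmono (le_max_left m n)) ⁻¹' (Subtype.val ⁻¹' (Q (max m n) \ C)),
    fun z hz => ⟨Set.mem_iUnion_of_mem _ hz.1, hz.2⟩,
    (hdiff (max m n)).preimage (hincl m (max m n) (le_max_left m n)),
    hQmono (le_max_right m n) hn, hxC⟩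

/-- The localization step of Proposition 3.4: for a direct limit sequence of T1 spaces,
increasing open sets `Q n ⊆ A n`, a continuous map `f` from a metrizable space `Y` and a
point `y` with `f y ∈ ⋃ n, Q n`, some neighbourhood of `y` is mapped into a single `Q n`. -/
theorem exists_nhd_mapsTo_of_directLimitSequence {X : Type*} [TopologicalSpace X]
    (A : ℕ → Set X) (t : ∀ n, TopologicalSpace (A n))
    (hmono : Monotone A)
    (hunion : ⋃ n, A n = Set.univ)
    (hincl : ∀ m n (h : m ≤ n),
      @Continuous _ _ (t m) (t n) (Set.inclusion (hmono h)))
    (hfinal : ∀ U : Set X, IsOpen U ↔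
      ∀ n, @IsOpen _ (t n) ((Subtype.val : A n → X) ⁻¹' U))
    (hT1 : ∀ n, @T1Space _ (t n))
    (Q : ℕ → Set X) (hQA : ∀ n, Q n ⊆ A n)
    (hQopen : ∀ n, @IsOpen _ (t n) ((Subtype.val : A n → X) ⁻¹' Q n))
    (hQmono : Monotone Q)
    {Y : Type*} [TopologicalSpace Y] [TopologicalSpace.MetrizableSpace Y]
    (f : Y → X) (hf : Continuous f) (y : Y) (hy : f y ∈ ⋃ n, Q n) :
    ∃ n, ∃ S : Set Y, IsOpen S ∧ y ∈ S ∧ f '' S ⊆ Q n := by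
  obtain ⟨N, hN⟩ := Set.mem_iUnion.1 hy
  obtain ⟨b, hb⟩ := (nhds y).exists_antitone_basis
  by_contra! hcon
  have hex (n : ℕ) : ∃ z ∈ b n, f z ∉ Q n := by
    obtain ⟨S, hSb, hS, hyS⟩ := mem_nhds_iff.1 (hb.mem n)
    obtain ⟨_, ⟨z, hz, rfl⟩, hzQ⟩ := Set.not_subset.1 (hcon n S hS hyS)
    exact ⟨z, hSb hz, hzQ⟩
  choose z hzb hzQ using hex
  let C : Set X := (fun k => f (z k)) '' Set.Ici N
  have hC (n : ℕ) : (Q n ∩ C).Finite := by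
    refine ((Set.finite_Iio n).image fun k => f (z k)).subset ?_
    rintro _ ⟨hk, k, -, rfl⟩
    exact ⟨k, not_le.1 fun h => hzQ k (hQmono h hk), rfl⟩
  have hyC : f y ∉ C := by
    rintro ⟨k, hk, hky : f (z k) = f y⟩
    exact hzQ k (hky ▸ hQmono hk hN)
  have hopen := isOpen_iUnion_diff_of_directLimitSequence A t hmono hincl hfinal hT1 Q hQopen
    hQmono C hC
  have hev := ((hf.tendsto y).comp (hb.tendsto hzb)).eventually_mem (hopen.mem_nhds ⟨hy, hyC⟩)
  obtain ⟨k, hk, hkN⟩ := (hev.and (Filter.eventually_ge_atTop N)).exists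
  exact hk.2 ⟨k, hkN, rfl⟩
end

section
/- Let X be a direct limit sequence of topological spaces (X_n, t_n), where each (X_n, t_n) is a T1 space and, in addition, each inclusion map (X_n, t_n) → X is a topological embedding (i.e., t_n equals the subspace topology induced by X). Let k ∈ ℕ and x ∈ X_k. Then the path component of x in X equals the union over n ≥ k of the path components of x in (X_n, t_n) (each viewed as a subset of X). -/
/-- If the topology of `X` is the final topology of an increasing sequence of `T1` spaces `A n`
covering `X`, then every compact subset of `X` is contained in some `A n`. -/
theorem IsCompact.exists_subset_of_directLimitSequence {X : Type*} [TopologicalSpace X]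
    {A : ℕ → Set X} (t : ∀ n, TopologicalSpace (A n)) (hmono : Monotone A)
    (hunion : ⋃ n, A n = Set.univ)
    (hfinal : ∀ U : Set X, IsOpen U ↔
      ∀ n, @IsOpen _ (t n) ((Subtype.val : A n → X) ⁻¹' U))
    (hT1 : ∀ n, @T1Space _ (t n)) {K : Set X} (hK : IsCompact K) :
    ∃ n, K ⊆ A n := by
  by_contra! h
  choose y hyK hyA using fun n => Set.not_subset.1 (h n)
  have hfin (m n : ℕ) : ((Subtype.val : A m → X) ⁻¹' (y '' Set.Ici n)).Finite := by
    refine (((Set.finite_Iio m).image y).subset ?_).of_finite_image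
      (f := Subtype.val) Subtype.val_injective.injOn
    rintro _ ⟨⟨_, hj⟩, ⟨j, -, rfl⟩, rfl⟩
    exact ⟨j, not_le.1 fun hmj => hyA j (hmono hmj hj), rfl⟩
  have hopen (n : ℕ) : IsOpen (y '' Set.Ici n)ᶜ := (hfinal _).2 fun m => by
    let := t m
    have := hT1 m
    exact (hfin m n).isClosed.isOpen_compl
  have hanti : Monotone fun n => (y '' Set.Ici n)ᶜ := fun _ _ hmn =>
    Set.compl_subset_compl.2 (Set.image_mono (Set.Ici_subset_Ici.2 hmn))
  obtain ⟨n, hn⟩ := hK.elim_directed_cover _ hopen (fun z _ => by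
    obtain ⟨m, hm⟩ := Set.mem_iUnion.1 (hunion.symm ▸ Set.mem_univ z)
    refine Set.mem_iUnion.2 ⟨m, ?_⟩
    rintro ⟨j, hmj, rfl⟩
    exact hyA j (hmono hmj hm)) hanti.directed_le
  exact hn (hyK n) ⟨n, Set.self_mem_Ici, rfl⟩


/-- Proposition 3.5 (path-component form, strict systems): if each inclusion
`(X n, t n) → X` is a topological embedding (i.e. `t n` is the subspace topology),
then the path component of `x ∈ X k` in `X` is the union over `n ≥ k` of the path
components of `x` in `(X n, t n)`. -/
theorem pathComponent_of_directLimitSequence {X : Type*} [topX : TopologicalSpace X]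
    (A : ℕ → Set X) (t : ∀ n, TopologicalSpace (A n))
    (hmono : Monotone A)
    (hunion : ⋃ n, A n = Set.univ)
    (hincl : ∀ m n (h : m ≤ n),
      @Continuous _ _ (t m) (t n) (Set.inclusion (hmono h)))
    (hfinal : ∀ U : Set X, IsOpen U ↔
      ∀ n, @IsOpen _ (t n) ((Subtype.val : A n → X) ⁻¹' U))
    (hT1 : ∀ n, @T1Space _ (t n))
    (hemb : ∀ n, t n = TopologicalSpace.induced (Subtype.val : A n → X) topX)
    (k : ℕ) (x : X) (hx : x ∈ A k) :
    pathComponent x =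
      ⋃ n, ⋃ (hn : k ≤ n),
        Subtype.val '' (@pathComponent _ (t n) ⟨x, hmono hn hx⟩) := by
  obtain rfl : t = fun _ => instTopologicalSpaceSubtype := funext hemb
  ext y
  simp only [Set.mem_iUnion, Set.mem_image]
  constructor
  · rintro ⟨γ⟩
    obtain ⟨n, hn⟩ := (isCompact_range γ.continuous).exists_subset_of_directLimitSequence
      _ hmono hunion hfinal hT1
    have hγ : JoinedIn (A (max k n)) x y :=
      ⟨γ, fun s => hmono (le_max_right k n) (hn ⟨s, rfl⟩)⟩
    exact ⟨max k n, le_max_left k n, ⟨y, hγ.target_mem⟩, hγ.joined_subtype, rfl⟩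
  · rintro ⟨n, hn, z, ⟨γ⟩, rfl⟩
    exact ⟨γ.map continuous_subtype_val⟩
end

section
/- Let B be a contractible topological space, F a real normed vector space, and E a topological real vector bundle over B with fibre F (a fibre bundle whose trivializations are fibrewise linear). Let P be an open subset of the total space of E which contains the zero section and is balanced, i.e., for every p ∈ P and every t ∈ [−1, 1] the fibrewise scalar multiple t·p lies in P. Then P (with the subspace topology from the total space) is a contractible topological space. -/
open Bundle

/-- Fibrewise scalar multiplication on the total space of a vector bundle is jointly
continuous in the scalar and the point. -/
theorem VectorBundle.continuous_smul_totalSpace (R : Type*) [NontriviallyNormedField R]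
    {B : Type*} [TopologicalSpace B] {F : Type*} [NormedAddCommGroup F] [NormedSpace R F]
    (E : B → Type*) [∀ b, AddCommGroup (E b)] [∀ b, Module R (E b)]
    [∀ b, TopologicalSpace (E b)] [TopologicalSpace (TotalSpace F E)]
    [FiberBundle F E] [VectorBundle R F E] :
    Continuous fun x : R × TotalSpace F E ↦ (⟨x.2.proj, x.1 • x.2.snd⟩ : TotalSpace F E) := by
  rw [continuous_iff_continuousAt]
  rintro ⟨t, p⟩
  rw [FiberBundle.continuousAt_totalSpace]
  have hproj : Continuous fun x : R × TotalSpace F E ↦ x.2.proj :=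
    (FiberBundle.continuous_proj F E).comp continuous_snd
  refine ⟨hproj.continuousAt, ?_⟩
  have htriv : ContinuousAt (trivializationAt F E p.proj) p :=
    (trivializationAt F E p.proj).continuousAt
      ((trivializationAt F E p.proj).mem_source.2 (mem_baseSet_trivializationAt F E p.proj))
  have hsmul : ContinuousAt
      (fun x : R × TotalSpace F E ↦ x.1 • (trivializationAt F E p.proj x.2).2) (t, p) :=
    continuousAt_fst.smul (htriv.snd.comp (f := Prod.snd) (x := (t, p)) continuousAt_snd)
  refine hsmul.congr ?_
  filter_upwards [hproj.continuousAt.preimage_mem_nhds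
    ((trivializationAt F E p.proj).open_baseSet.mem_nhds
      (mem_baseSet_trivializationAt F E p.proj))] with x hx
  exact (((trivializationAt F E p.proj).linear R hx).map_smul x.1 x.2.snd).symm

/-- The contractibility claim at the end of the proof of Lemma 2.1: a balanced open
neighbourhood `P` of the zero section of a topological real vector bundle over a
contractible base is contractible. -/
theorem contractible_balanced_nhd_of_zeroSection
    {B : Type*} [TopologicalSpace B] [ContractibleSpace B]
    {F : Type*} [NormedAddCommGroup F] [NormedSpace ℝ F]
    (E : B → Type*) [∀ b, AddCommGroup (E b)] [∀ b, Module ℝ (E b)]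
    [∀ b, TopologicalSpace (E b)] [TopologicalSpace (TotalSpace F E)]
    [FiberBundle F E] [VectorBundle ℝ F E]
    (P : Set (TotalSpace F E)) (hPopen : IsOpen P)
    (hPzero : ∀ b : B, (⟨b, 0⟩ : TotalSpace F E) ∈ P)
    (hPbal : ∀ p ∈ P, ∀ t : ℝ, t ∈ Set.Icc (-1 : ℝ) 1 →
      (⟨p.proj, t • p.snd⟩ : TotalSpace F E) ∈ P) :
    ContractibleSpace P := by
  let proj : C(P, B) :=
    ⟨fun p ↦ p.1.proj, (FiberBundle.continuous_proj F E).comp continuous_subtype_val⟩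
  let zero : C(B, P) :=
    ⟨fun b ↦ ⟨zeroSection F E b, hPzero b⟩, (Trivialization.continuous_zeroSection ℝ).subtype_mk _⟩
  let scaling : (zero.comp proj).Homotopy (ContinuousMap.id P) :=
    { toFun := fun x ↦ ⟨⟨x.2.1.proj, (x.1 : ℝ) • x.2.1.snd⟩,
        hPbal _ x.2.2 _ ⟨by linarith [x.1.2.1], x.1.2.2⟩⟩
      continuous_toFun := by
        refine Continuous.subtype_mk ?_ _
        exact (VectorBundle.continuous_smul_totalSpace ℝ E).comp
          (f := fun x : unitInterval × P ↦ ((x.1 : ℝ), x.2.1)) (by fun_prop)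
      map_zero_left := fun p ↦ by simp [zero, proj, zeroSection]
      map_one_left := fun p ↦ by simp }
  let equiv : ContinuousMap.HomotopyEquiv P B :=
    { toFun := proj
      invFun := zero
      left_inv := ⟨scaling⟩
      right_inv := by
        rw [show proj.comp zero = ContinuousMap.id B from rfl] }
  exact equiv.contractibleSpace
end
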